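/- For every n ≥ 0 and 0 ≤ k ≤ n, the k-th derivative of the monic Jacobi polynomial at x = −1 is (dᵏ/dxᵏ) Pₙ^{(α,β)}(−1) = [n!/(n−k)!] · (−2)^{n−k} (β+k+1)_{n−k} / (α+β+n+k+1)_{n−k}, where (x)ₘ denotes the rising factorial x(x+1)⋯(x+m−1). -/

import Mathlib

open MeasureTheory Polynomial

lemma jac_weight_integrable (α β : ℝ) (hα : -1 < α) (hβ : -1 < β) :
    IntervalIntegrable (fun x : ℝ => (1 - x) ^ α * (1 + x) ^ β) volume (-1) 1 := by
  have h1 : IntervalIntegrable (fun x : ℝ => (1 + x) ^ β) volume (-1) 0 := by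
    have := (intervalIntegral.intervalIntegrable_rpow' (a := 0) (b := 1) hβ).comp_add_left 1
    simpa using this
  have h2 : IntervalIntegrable (fun x : ℝ => (1 - x) ^ α) volume 0 1 := by
    have := (intervalIntegral.intervalIntegrable_rpow' (a := 1) (b := 0) hα).comp_sub_left 1
    simpa using this
  have h3 : ContinuousOn (fun x : ℝ => (1 - x) ^ α) (Set.uIcc (-1) 0) := by
    intro x hx
    rw [Set.uIcc_of_le (by norm_num)] at hx
    refine ContinuousAt.continuousWithinAt ?_
    refine ContinuousAt.rpow_const (by fun_prop) (Or.inl ?_)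
    have := hx.2
    intro h
    linarith
  have h4 : ContinuousOn (fun x : ℝ => (1 + x) ^ β) (Set.uIcc 0 1) := by
    intro x hx
    rw [Set.uIcc_of_le (by norm_num)] at hx
    refine ContinuousAt.continuousWithinAt ?_
    refine ContinuousAt.rpow_const (by fun_prop) (Or.inl ?_)
    have := hx.1
    intro h
    linarith
  exact (h1.continuousOn_mul h3).trans (h2.mul_continuousOn h4)

lemma jac_poly_integrable (α β : ℝ) (hα : -1 < α) (hβ : -1 < β) (p : ℝ[X]) :
    IntervalIntegrable (fun x : ℝ => p.eval x * ((1 - x) ^ α * (1 + x) ^ β)) volume (-1) 1 :=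
  (jac_weight_integrable α β hα hβ).continuousOn_mul p.continuous.continuousOn

/-- The integration functional against the Jacobi weight. -/
noncomputable def jacI (α β : ℝ) (p : ℝ[X]) : ℝ :=
  ∫ x in (-1 : ℝ)..1, p.eval x * ((1 - x) ^ α * (1 + x) ^ β)

lemma jacI_add (α β : ℝ) (hα : -1 < α) (hβ : -1 < β) (p q : ℝ[X]) :
    jacI α β (p + q) = jacI α β p + jacI α β q := by
  unfold jacI
  rw [← intervalIntegral.integral_add (jac_poly_integrable α β hα hβ p)
    (jac_poly_integrable α β hα hβ q)]
  congr 1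
  ext x
  simp only [eval_add]
  ring

lemma jacI_smul (α β : ℝ) (c : ℝ) (p : ℝ[X]) :
    jacI α β (C c * p) = c * jacI α β p := by
  unfold jacI
  rw [← intervalIntegral.integral_const_mul]
  congr 1
  ext x
  simp only [eval_mul, eval_C]
  ring

/-- The Jacobi differential operator. -/
noncomputable def jacL (α β : ℝ) (p : ℝ[X]) : ℝ[X] :=
  (1 - X ^ 2) * derivative (derivative p) + (C (β - α) - C (α + β + 2) * X) * derivative p

lemma jacI_symm (α β : ℝ) (hα : -1 < α) (hβ : -1 < β) (p q : ℝ[X]) :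
    jacI α β (jacL α β p * q + C (-1) * (p * jacL α β q)) = 0 := by
  unfold jacI
  set g : ℝ[X] := derivative p * q - p * derivative q with hg
  have key := intervalIntegral.integral_eq_sub_of_hasDerivAt_of_le (a := -1) (b := 1)
    (f := fun x : ℝ => g.eval x * ((1 - x) ^ (α + 1) * (1 + x) ^ (β + 1))) (by norm_num)
    ?_ ?_ (jac_poly_integrable α β hα hβ (jacL α β p * q + C (-1) * (p * jacL α β q)))
  · rw [key]
    have e1 : (0 : ℝ) ^ (α + 1) = 0 := Real.zero_rpow (by linarith)
    have e2 : (0 : ℝ) ^ (β + 1) = 0 := Real.zero_rpow (by linarith)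
    norm_num [e1, e2]
  · refine ContinuousOn.mul g.continuous.continuousOn (Continuous.continuousOn ?_)
    refine Continuous.mul ?_ ?_
    · exact Continuous.rpow_const (by fun_prop) (fun x => Or.inr (by linarith))
    · exact Continuous.rpow_const (by fun_prop) (fun x => Or.inr (by linarith))
  · intro x hx
    have hx1 : 0 < 1 - x := by linarith [hx.2]
    have hx2 : 0 < 1 + x := by linarith [hx.1]
    have d1 : HasDerivAt (fun x : ℝ => (1 - x) ^ (α + 1)) (-1 * (α + 1) * (1 - x) ^ (α + 1 - 1)) x :=
      ((hasDerivAt_id x).const_sub 1).rpow_const (Or.inl hx1.ne')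
    have d2 : HasDerivAt (fun x : ℝ => (1 + x) ^ (β + 1)) (1 * (β + 1) * (1 + x) ^ (β + 1 - 1)) x :=
      ((hasDerivAt_id x).const_add 1).rpow_const (Or.inl hx2.ne')
    refine ((g.hasDerivAt x).mul (d1.mul d2)).congr_deriv ?_
    have r1 : (1 - x) ^ (α + 1) = (1 - x) ^ α * (1 - x) := by
      rw [Real.rpow_add hx1, Real.rpow_one]
    have r2 : (1 + x) ^ (β + 1) = (1 + x) ^ β * (1 + x) := by
      rw [Real.rpow_add hx2, Real.rpow_one]
    simp only [add_sub_cancel_right, Pi.mul_apply, r1, r2, hg, jacL, derivative_sub, derivative_mul,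
      eval_add, eval_sub, eval_mul, eval_C, eval_X, eval_pow, eval_one]
    ring

lemma jac_orth (α β : ℝ) (hα : -1 < α) (hβ : -1 < β)
    (P : ℕ → Polynomial ℝ)
    (hmonic : ∀ n, (P n).Monic) (hdeg : ∀ n, (P n).natDegree = n)
    (horth : ∀ m n : ℕ, m ≠ n → jacI α β (P m * P n) = 0) (n : ℕ) :
    ∀ d ≤ n, ∀ q : ℝ[X], q.degree < d → jacI α β (q * P n) = 0 := by
  intro d
  induction d with
  | zero =>
    intro _ q hq
    have : q = 0 := by
      rw [← Polynomial.degree_eq_bot]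
      simpa using hq
    simp [this, jacI]
  | succ d ih =>
    intro hd q hq
    have hq' : (q + C (-(q.coeff d)) * P d).degree < d := by
      rw [Polynomial.degree_lt_iff_coeff_zero] at hq ⊢
      intro m hm
      rw [coeff_add, coeff_C_mul]
      rcases Nat.eq_or_lt_of_le hm with h | h
      · subst h
        have : (P d).coeff d = 1 := by
          have := hmonic d
          rw [Polynomial.Monic, Polynomial.leadingCoeff, hdeg] at this
          exact this
        rw [this]
        ring
      · rw [hq m h, Polynomial.coeff_eq_zero_of_natDegree_lt (p := P d) (by rw [hdeg]; exact h)]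
        ring
    have h1 := ih (by omega) _ hq'
    rw [add_mul, mul_assoc, jacI_add α β hα hβ, jacI_smul, horth d n (by omega)] at h1
    simpa using h1

lemma jac_pos (α β : ℝ) (hα : -1 < α) (hβ : -1 < β) (r : ℝ[X])
    (h : jacI α β (r * r) = 0) : r = 0 := by
  by_contra hr
  have hi := jac_poly_integrable α β hα hβ (r * r)
  unfold jacI at h
  rw [intervalIntegrable_iff_integrableOn_Ioo_of_le (by norm_num)] at hi
  rw [intervalIntegral.integral_of_le (by norm_num), integral_Ioc_eq_integral_Ioo] at h
  rw [setIntegral_eq_zero_iff_of_nonneg_ae ?_ hi] at h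
  · have h0 : ∀ᵐ x : ℝ ∂(volume.restrict (Set.Ioo (-1) 1)), x ∉ r.rootSet ℝ := by
      refine ae_restrict_of_ae ?_
      exact (Set.Finite.countable (Polynomial.rootSet_finite r ℝ)).ae_notMem _
    have hF : ∀ᵐ x : ℝ ∂(volume.restrict (Set.Ioo (-1) 1)), False := by
      filter_upwards [h, h0, ae_restrict_mem measurableSet_Ioo] with x h1 h2 hx
      have hx1 : 0 < 1 - x := by linarith [hx.2]
      have hx2 : 0 < 1 + x := by linarith [hx.1]
      apply h2
      rw [Polynomial.mem_rootSet]
      refine ⟨hr, ?_⟩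
      have p1 := Real.rpow_pos_of_pos hx1 α
      have p2 := Real.rpow_pos_of_pos hx2 β
      have : r.eval x = 0 := by
        simpa [p1.ne', p2.ne'] using h1
      simpa using this
    rw [ae_iff] at hF
    simp only [not_false_eq_true, Set.setOf_true, Measure.restrict_apply_univ,
      Real.volume_Ioo] at hF
    norm_num at hF
  · filter_upwards [ae_restrict_mem measurableSet_Ioo] with x hx
    have hx1 : 0 < 1 - x := by linarith [hx.2]
    have hx2 : 0 < 1 + x := by linarith [hx.1]
    have p1 := Real.rpow_pos_of_pos hx1 α
    have p2 := Real.rpow_pos_of_pos hx2 β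
    rw [eval_mul]
    exact mul_nonneg (mul_self_nonneg _) (by positivity)

lemma jacL_coeff (α β : ℝ) (p : ℝ[X]) (m : ℕ) :
    (jacL α β p).coeff m = (p.coeff (m + 2)) * ((m + 1) * (m + 2))
      + (β - α) * (p.coeff (m + 1) * (m + 1)) - (m * (m + α + β + 1)) * p.coeff m := by
  have e : jacL α β p = derivative (derivative p) - X * (X * derivative (derivative p))
      + (C (β - α) * derivative p - C (α + β + 2) * (X * derivative p)) := by
    unfold jacL; ring
  rw [e]
  rcases m with _ | _ | m
  · simp only [coeff_add, coeff_sub, coeff_C_mul, coeff_X_mul_zero, coeff_derivative]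
    push_cast
    ring
  · simp only [coeff_add, coeff_sub, coeff_C_mul, coeff_X_mul, coeff_X_mul_zero, coeff_derivative]
    push_cast
    ring
  · simp only [coeff_add, coeff_sub, coeff_C_mul, coeff_X_mul, coeff_derivative]
    push_cast
    ring

lemma jacL_degree (α β : ℝ) (p : ℝ[X]) (d : ℕ) (hp : p.degree < d) :
    (jacL α β p).degree < d := by
  rw [Polynomial.degree_lt_iff_coeff_zero] at hp ⊢
  intro m hm
  rw [jacL_coeff, hp m hm, hp (m + 1) (by omega), hp (m + 2) (by omega)]
  ring

lemma jac_ode (α β : ℝ) (hα : -1 < α) (hβ : -1 < β)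
    (P : ℕ → Polynomial ℝ)
    (hmonic : ∀ n, (P n).Monic) (hdeg : ∀ n, (P n).natDegree = n)
    (horth : ∀ m n : ℕ, m ≠ n → jacI α β (P m * P n) = 0) (n : ℕ) :
    jacL α β (P n) + C (n * (n + α + β + 1)) * P n = 0 := by
  have ho := jac_orth α β hα hβ P hmonic hdeg horth n n le_rfl
  set r := jacL α β (P n) + C (n * (n + α + β + 1)) * P n with hr
  have hrd : r.degree < n := by
    rw [Polynomial.degree_lt_iff_coeff_zero]
    intro m hm
    rw [hr, coeff_add, coeff_C_mul, jacL_coeff,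
      Polynomial.coeff_eq_zero_of_natDegree_lt (p := P n) (n := m + 1) (by rw [hdeg]; omega),
      Polynomial.coeff_eq_zero_of_natDegree_lt (p := P n) (n := m + 2) (by rw [hdeg]; omega)]
    rcases Nat.eq_or_lt_of_le hm with h | h
    · subst h; ring
    · rw [Polynomial.coeff_eq_zero_of_natDegree_lt (p := P n) (n := m) (by rw [hdeg]; omega)]
      ring
  apply jac_pos α β hα hβ
  have h1 := jacI_symm α β hα hβ (P n) r
  rw [jacI_add α β hα hβ, jacI_smul, mul_comm (P n), ho _ (jacL_degree α β r n hrd)] at h1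
  have h2 := ho r hrd
  have e : r * r = jacL α β (P n) * r + C (n * (n + α + β + 1)) * (r * P n) := by
    nth_rewrite 1 [hr]; ring
  rw [e, jacI_add α β hα hβ, jacI_smul, h2]
  linarith

lemma jac_ode_iter (α β c : ℝ) (p : ℝ[X]) (h : jacL α β p + C c * p = 0) (k : ℕ) :
    (1 - X ^ 2) * derivative^[k + 2] p
      + (C (β - α) - C (α + β + 2 + 2 * k) * X) * derivative^[k + 1] p
      + C (c - k * (k + α + β + 1)) * derivative^[k] p = 0 := by
  induction k with
  | zero =>
    simpa [jacL] using h
  | succ k ih =>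
    have := congrArg derivative ih
    simp only [derivative_add, derivative_mul, derivative_sub, derivative_C, derivative_X_pow,
      derivative_X, derivative_one, derivative_zero, ← Function.iterate_succ_apply'] at this
    rw [← this]
    simp only [map_add, map_sub, map_mul, Nat.cast_add, Nat.cast_one, map_one]
    push_cast
    simp only [Nat.succ_eq_add_one, C_ofNat, pow_one,
      show k + 1 + 2 = k + 2 + 1 from rfl, show k + 1 + 1 = k + 2 from rfl]
    norm_num
    ring

/-- for every `n ≥ 0` and `0 ≤ k ≤ n`, the `k`-th derivative of the
monic Jacobi polynomial at `x = -1` is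
`(dᵏ/dxᵏ) Pₙ^{(α,β)}(-1) = [n!/(n-k)!] (-2)^(n-k) (β+k+1)_{n-k} / (α+β+n+k+1)_{n-k}`,
where `(x)ₘ` is the rising factorial. -/
theorem jacobi_iterated_derivative_at_neg_one
    (α β : ℝ) (hα : -1 < α) (hβ : -1 < β)
    (P : ℕ → Polynomial ℝ)
    (hmonic : ∀ n, (P n).Monic) (hdeg : ∀ n, (P n).natDegree = n)
    (horth : ∀ m n : ℕ, m ≠ n →
      ∫ x in (-1 : ℝ)..1, (P m).eval x * (P n).eval x * ((1 - x) ^ α * (1 + x) ^ β) = 0) :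
    ∀ n k : ℕ, k ≤ n →
      ((Polynomial.derivative^[k]) (P n)).eval (-1)
        = ((n.factorial : ℝ) / ((n - k).factorial : ℝ)) *
            ((-2 : ℝ) ^ (n - k) *
              (ascPochhammer ℝ (n - k)).eval (β + (k : ℝ) + 1) /
              (ascPochhammer ℝ (n - k)).eval (α + β + (n : ℝ) + (k : ℝ) + 1)) := by
  have horth' : ∀ m n : ℕ, m ≠ n → jacI α β (P m * P n) = 0 := by
    intro m n h
    simpa [jacI] using horth m n h
  intro n
  have ode := jac_ode α β hα hβ P hmonic hdeg horth' n
  suffices H : ∀ j k : ℕ, k + j = n →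
      ((Polynomial.derivative^[k]) (P n)).eval (-1)
        = ((n.factorial : ℝ) / (j.factorial : ℝ)) *
            ((-2 : ℝ) ^ j * (ascPochhammer ℝ j).eval (β + (k : ℝ) + 1) /
              (ascPochhammer ℝ j).eval (α + β + (n : ℝ) + (k : ℝ) + 1)) by
    intro k hk
    exact H (n - k) k (by omega)
  intro j
  induction j with
  | zero =>
    intro k hk
    obtain rfl : k = n := by omega
    have h1 : (P k).coeff k = 1 := by
      have := hmonic k
      rw [Polynomial.Monic, Polynomial.leadingCoeff, hdeg] at this
      exact this
    have h2 : (derivative^[k] (P k)).natDegree = 0 := by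
      have := Polynomial.natDegree_iterate_derivative (P k) k
      rw [hdeg] at this
      omega
    rw [Polynomial.eq_C_of_natDegree_eq_zero h2, eval_C, coeff_iterate_derivative]
    simp [h1, Nat.descFactorial_self]
  | succ j ih =>
    intro k hk
    have h1 := ih (k + 1) (by omega)
    have h2 := congrArg (eval (-1)) (jac_ode_iter α β _ _ ode k)
    have hn : (n : ℝ) = k + j + 1 := by rw [← hk]; push_cast; ring
    have hk0 : (0 : ℝ) ≤ k := Nat.cast_nonneg k
    have hj0 : (0 : ℝ) ≤ j := Nat.cast_nonneg j
    have hpos : 0 < α + β + n + k + 1 := by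
      rcases Nat.eq_zero_or_pos n with h | h
      · omega
      · have : (1 : ℝ) ≤ n := by exact_mod_cast h
        linarith
    have hA : 0 < (ascPochhammer ℝ j).eval (α + β + (n : ℝ) + (k : ℝ) + 1 + 1) :=
      ascPochhammer_pos _ _ (by linarith)
    simp only [eval_add, eval_mul, eval_sub, eval_one, eval_pow, eval_X, eval_C, eval_zero] at h2
    rw [h1] at h2
    rw [ascPochhammer_succ_left, eval_mul, eval_mul, eval_X, eval_comp, eval_comp, eval_add, eval_X,
      eval_X, eval_one, eval_add, eval_X, eval_one, Nat.factorial_succ]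
    push_cast at h2 ⊢
    rw [show β + ((k : ℝ) + 1) + 1 = β + k + 1 + 1 by ring,
      show α + β + (n : ℝ) + ((k : ℝ) + 1) + 1 = α + β + n + k + 1 + 1 by ring] at h2
    have hf : (0 : ℝ) < j.factorial := by exact_mod_cast j.factorial_pos
    generalize (ascPochhammer ℝ j).eval (α + β + (n : ℝ) + (k : ℝ) + 1 + 1) = A at *
    generalize (ascPochhammer ℝ j).eval (β + (k : ℝ) + 1 + 1) = B at *
    generalize (derivative^[k] (P n)).eval (-1) = y at *
    have hc : (n * (n + α + β + 1) - k * (k + α + β + 1) : ℝ)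
        = (j + 1) * (α + β + n + k + 1) := by
      rw [hn]; ring
    rw [hc] at h2
    have hj1 : (j : ℝ) + 1 ≠ 0 := by positivity
    have hne : ((j : ℝ) + 1) * (α + β + n + k + 1) ≠ 0 := mul_ne_zero hj1 hpos.ne'
    apply mul_left_cancel₀ hne
    have h3 : ((j : ℝ) + 1) * (α + β + n + k + 1) * y = -2 * (β + k + 1) *
      (n.factorial / j.factorial * ((-2) ^ j * B / A)) := by linear_combination h2
    rw [h3]
    have := hpos.ne'
    field_simp
    ring
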